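/- Let σ be a classical symbol of order a on ℝ^d with homogeneous components σ_{a−j}. For Re(z) > Re(a)+d the series Σ_{n∈ℤ^d∖{0}} σ(n) |n|^{−z} converges absolutely (|n| the euclidean norm), and there is a function F : ℂ → ℂ, analytic on ℂ∖{a+d−j : j ∈ ℕ}, with F(z) = Σ_{n∈ℤ^d∖{0}} σ(n) |n|^{−z} for Re(z) > Re(a)+d, such that for each j ∈ ℕ the function z ↦ F(z) − ( ∫_{S^{d−1}} σ_{a−j} dμ_S ) / (z − (a+d−j)) extends analytically to a neighbourhood of a+d−j. Thus the Dirichlet-type series of σ has a meromorphic extension to ℂ with at most simple poles at the points a+d−j, j ∈ ℕ, with residue ∫_{S^{d−1}} σ_{a−j} dμ_S at a+d−j. -/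

import Mathlib

open MeasureTheory Filter Finset Complex Metric
open scoped Topology Pointwise Classical

noncomputable section

/-- A smooth cut-off function on `ℝ^d`: vanishes near `0`, identically `1` for `|x| ≥ 1`. -/
structure IsCutoff {d : ℕ} (χ : EuclideanSpace ℝ (Fin d) → ℝ) : Prop where
  smooth : ContDiff ℝ (⊤ : ℕ∞) χ
  eq_zero_near : ∃ ε > (0 : ℝ), ∀ x : EuclideanSpace ℝ (Fin d), ‖x‖ < ε → χ x = 0
  eq_one_far : ∀ x : EuclideanSpace ℝ (Fin d), 1 ≤ ‖x‖ → χ x = 1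

/-- `σ` is a classical symbol (with constant coefficients) of order `a ∈ ℂ` on `ℝ^d`, with
positively homogeneous components `σh j` of degree `a − j` and cut-off `χ`: for every `N` the
function `σ − Σ_{j<N} χ σh j` together with all its derivatives is
`O((1+|x|)^{Re a − N − k})`. -/
structure IsClassicalSymbol {d : ℕ} (χ : EuclideanSpace ℝ (Fin d) → ℝ) (a : ℂ)
    (σ : EuclideanSpace ℝ (Fin d) → ℂ) (σh : ℕ → EuclideanSpace ℝ (Fin d) → ℂ) : Prop where
  smooth : ContDiff ℝ (⊤ : ℕ∞) σ
  smooth_homog : ∀ j : ℕ, ContDiffOn ℝ (⊤ : ℕ∞) (σh j) {x : EuclideanSpace ℝ (Fin d) | x ≠ 0}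
  homog : ∀ j : ℕ, ∀ t : ℝ, 0 < t → ∀ x : EuclideanSpace ℝ (Fin d), x ≠ 0 →
    σh j (t • x) = (t : ℂ) ^ (a - (j : ℂ)) * σh j x
  estimate : ∀ N k : ℕ, ∃ C : ℝ, ∀ x : EuclideanSpace ℝ (Fin d),
    ‖iteratedFDeriv ℝ k
        (fun y : EuclideanSpace ℝ (Fin d) => σ y - ∑ j ∈ Finset.range N, (χ y : ℂ) * σh j y) x‖
      ≤ C * (1 + ‖x‖) ^ (a.re - N - k)

/-- The surface measure `μ_S` on the unit sphere `S^{d−1} ⊂ ℝ^d` induced by Lebesgue measure. -/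
noncomputable def sphereMeasure (d : ℕ) : Measure (sphere (0 : EuclideanSpace ℝ (Fin d)) 1) :=
  (volume : Measure (EuclideanSpace ℝ (Fin d))).toSphere

/-- The vector of `ℝ^d` with integer coordinates `p ∈ ℤ^d`. -/
noncomputable def intVec {d : ℕ} (p : Fin d → ℤ) : EuclideanSpace ℝ (Fin d) :=
  (EuclideanSpace.equiv (Fin d) ℝ).symm fun i => (p i : ℝ)

section Lattice

variable {d : ℕ} {V : Type} [NormedAddCommGroup V]

@[simp] lemma intVec_apply (n : Fin d → ℤ) (i : Fin d) : intVec n i = n i := rfl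

@[simp] lemma intVec_zero : intVec (0 : Fin d → ℤ) = 0 := by
  ext i; simp

lemma intVec_add (m n : Fin d → ℤ) : intVec (m + n) = intVec m + intVec n := by
  ext i; simp

lemma intVec_injective : Function.Injective (intVec : (Fin d → ℤ) → _) := by
  intro m n h
  ext i
  have := congrArg (fun v : EuclideanSpace ℝ (Fin d) => v i) h
  simpa using this

lemma intVec_single (i : Fin d) :
    intVec (Pi.single i (1 : ℤ)) = EuclideanSpace.single i (1 : ℝ) := by
  ext j
  by_cases h : j = i
  · subst h; simp
  · simp [h]

lemma one_le_norm_intVec {n : Fin d → ℤ} (hn : n ≠ 0) : 1 ≤ ‖intVec n‖ := by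
  obtain ⟨i, hi⟩ := Function.ne_iff.1 hn
  refine le_trans ?_ (PiLp.norm_apply_le (intVec n) i)
  rw [intVec_apply, Real.norm_eq_abs, ← Int.cast_abs]
  exact_mod_cast Int.one_le_abs hi

lemma norm_intVec_pos {n : Fin d → ℤ} (hn : n ≠ 0) : 0 < ‖intVec n‖ :=
  one_pos.trans_le (one_le_norm_intVec hn)

lemma intVec_ne_zero {n : Fin d → ℤ} (hn : n ≠ 0) : intVec n ≠ 0 :=
  norm_pos_iff.1 (norm_intVec_pos hn)

/-- `∑_{n ≠ 0} |n| ^ r` converges for `r < -d`. -/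
lemma summable_norm_intVec_rpow {r : ℝ} (hr : r < -d) :
    Summable fun n : {n : Fin d → ℤ // n ≠ 0} => ‖intVec n.1‖ ^ r := by
  let b := (EuclideanSpace.basisFun (Fin d) ℝ).toBasis
  let L := Submodule.span ℤ (Set.range b)
  have hL : Module.finrank ℤ L = d := by
    rw [ZLattice.rank ℝ L]; simp
  have hmem : ∀ n : Fin d → ℤ, intVec n ∈ L := by
    intro n
    have : intVec n = ∑ i, n i • b i := by
      ext j
      simp [b, Finset.sum_apply, Pi.single_apply]
    rw [this]
    exact Submodule.sum_mem _ fun i _ => Submodule.smul_mem _ _ (Submodule.subset_span ⟨i, rfl⟩)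
  have h := ZLattice.summable_norm_rpow L r (by rw [hL]; exact hr)
  exact h.comp_injective (i := fun n : {n : Fin d → ℤ // n ≠ 0} => (⟨intVec n.1, hmem n.1⟩ : L))
    fun m n hmn => Subtype.ext (intVec_injective (congrArg Subtype.val hmn))

/-- A finite box of indices containing every `n` with `‖y + t n‖ ≤ R`. -/
def latticeBox (R t : ℝ) (y : EuclideanSpace ℝ (Fin d)) : Finset (Fin d → ℤ) :=
  Fintype.piFinset fun i => Finset.Icc ⌈(-R - y i) / t⌉ ⌊(R - y i) / t⌋

lemma mem_latticeBox {R t : ℝ} (ht : 0 < t) {y : EuclideanSpace ℝ (Fin d)} {n : Fin d → ℤ}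
    (h : ‖y + t • intVec n‖ ≤ R) : n ∈ latticeBox R t y := by
  rw [latticeBox, Fintype.mem_piFinset]
  intro i
  have := (PiLp.norm_apply_le (y + t • intVec n) i).trans h
  simp only [PiLp.add_apply, PiLp.smul_apply, intVec_apply, smul_eq_mul, Real.norm_eq_abs,
    abs_le] at this
  rw [Finset.mem_Icc, Int.ceil_le, Int.le_floor, div_le_iff₀ ht, le_div_iff₀ ht]
  constructor <;> linarith

lemma card_latticeBox_le {R t : ℝ} (hR : 0 ≤ R) (ht : 0 < t) (ht1 : t ≤ 1)
    (y : EuclideanSpace ℝ (Fin d)) : ((latticeBox R t y).card : ℝ) ≤ ((2 * R + 1) / t) ^ d := by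
  rw [latticeBox, Fintype.card_piFinset, Nat.cast_prod]
  calc _ ≤ ∏ _i : Fin d, ((2 * R + 1) / t) := by
        refine Finset.prod_le_prod (fun _ _ => by positivity) fun i _ => ?_
        rw [Int.card_Icc]
        have h0 : (0 : ℝ) ≤ (2 * R + 1) / t := by positivity
        have h1 : (((⌊(R - y i) / t⌋ + 1 - ⌈(-R - y i) / t⌉ : ℤ)) : ℝ) ≤ (2 * R + 1) / t := by
          push_cast
          have h2 := Int.floor_le ((R - y i) / t)
          have h3 := Int.le_ceil ((-R - y i) / t)
          have h4 : 1 ≤ 1 / t := by rw [le_div_iff₀ ht]; linarith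
          have h5 : (2 * R + 1) / t = (R - y i) / t - (-R - y i) / t + 1 / t := by ring
          linarith
        rw [← Int.cast_natCast, Int.toNat_eq_max, Int.cast_max, Int.cast_zero]
        exact max_le h1 h0
    _ = _ := by rw [Finset.prod_const, Finset.card_univ, Fintype.card_fin]

/-- The sum of `F` over the shifted and scaled lattice `y + t ℤ^d`. -/
def latticeSum (F : EuclideanSpace ℝ (Fin d) → V) (t : ℝ) (y : EuclideanSpace ℝ (Fin d)) : V :=
  ∑' n : Fin d → ℤ, F (y + t • intVec n)

lemma latticeSum_eq_sum {F : EuclideanSpace ℝ (Fin d) → V} {R t : ℝ} (ht : 0 < t)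
    (hF : ∀ x, R < ‖x‖ → F x = 0) {y : EuclideanSpace ℝ (Fin d)} {T : Finset (Fin d → ℤ)}
    (hT : latticeBox R t y ⊆ T) : latticeSum F t y = ∑ n ∈ T, F (y + t • intVec n) :=
  tsum_eq_sum fun _ hn => hF _ (not_le.1 fun h => hn (hT (mem_latticeBox ht h)))

lemma norm_latticeSum_le {F : EuclideanSpace ℝ (Fin d) → V} {R t B : ℝ} (hR : 0 ≤ R) (ht : 0 < t)
    (ht1 : t ≤ 1) (hF : ∀ x, R < ‖x‖ → F x = 0) (hB : ∀ x, ‖F x‖ ≤ B)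
    (y : EuclideanSpace ℝ (Fin d)) : ‖latticeSum F t y‖ ≤ ((2 * R + 1) / t) ^ d * B := by
  have hB0 : 0 ≤ B := (norm_nonneg _).trans (hB 0)
  rw [latticeSum_eq_sum ht hF subset_rfl]
  calc _ ≤ ∑ _n ∈ latticeBox R t y, B := norm_sum_le_of_le _ fun _ _ => hB _
    _ = (latticeBox R t y).card * B := by simp
    _ ≤ _ := by gcongr; exact card_latticeBox_le hR ht ht1 y

lemma latticeSum_eventuallyEq {F : EuclideanSpace ℝ (Fin d) → V} {R t : ℝ} (ht : 0 < t)
    (hF : ∀ x, R < ‖x‖ → F x = 0) (y₀ : EuclideanSpace ℝ (Fin d)) :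
    latticeSum F t =ᶠ[𝓝 y₀]
      fun y => ∑ n ∈ latticeBox (R + 1) t y₀, F (y + t • intVec n) := by
  filter_upwards [Metric.ball_mem_nhds y₀ one_pos] with y hy
  refine tsum_eq_sum fun n hn => hF _ (not_le.1 fun h => hn (mem_latticeBox ht ?_))
  have : y₀ + t • intVec n = (y + t • intVec n) - (y - y₀) := by abel
  rw [this]
  refine (norm_sub_le _ _).trans ?_
  rw [mem_ball, dist_eq_norm] at hy
  linarith

lemma hasFDerivAt_latticeSum [NormedSpace ℝ V] {F : EuclideanSpace ℝ (Fin d) → V} {R t : ℝ} (ht : 0 < t)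
    (hF : ∀ x, R < ‖x‖ → F x = 0) (hd : Differentiable ℝ F) (y₀ : EuclideanSpace ℝ (Fin d))
    (hF' : ∀ x, R < ‖x‖ → fderiv ℝ F x = 0) :
    HasFDerivAt (latticeSum F t) (latticeSum (fderiv ℝ F) t y₀) y₀ := by
  refine HasFDerivAt.congr_of_eventuallyEq ?_ (latticeSum_eventuallyEq ht hF y₀)
  rw [(latticeSum_eventuallyEq ht hF' y₀).eq_of_nhds]
  refine HasFDerivAt.fun_sum fun n _ => ?_
  exact (hasFDerivAt_comp_add_right (t • intVec n)).2 (hd _).hasFDerivAt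

lemma latticeSum_add_smul_intVec (F : EuclideanSpace ℝ (Fin d) → V) (t : ℝ)
    (y : EuclideanSpace ℝ (Fin d)) (m : Fin d → ℤ) :
    latticeSum F t (y + t • intVec m) = latticeSum F t y := by
  rw [latticeSum, latticeSum,
    ← (Equiv.addLeft m).tsum_eq (fun n => F (y + t • intVec n))]
  refine tsum_congr fun n => ?_
  simp [intVec_add, add_assoc]

end Lattice

section RiemannSum

variable {d : ℕ}

lemma exists_tsupport_subset_closedBall {V : Type} [NormedAddCommGroup V]
    {F : EuclideanSpace ℝ (Fin d) → V} (hc : HasCompactSupport F) :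
    ∃ R : ℝ, 0 ≤ R ∧ tsupport F ⊆ closedBall 0 R := by
  obtain ⟨R, hR⟩ := hc.isCompact.isBounded.subset_closedBall 0
  exact ⟨max R 0, le_max_right _ _, hR.trans (closedBall_subset_closedBall (le_max_left _ _))⟩

lemma eq_zero_of_lt_norm {V : Type} [NormedAddCommGroup V]
    {F : EuclideanSpace ℝ (Fin d) → V} {R : ℝ} (h : tsupport F ⊆ closedBall 0 R)
    (x : EuclideanSpace ℝ (Fin d)) (hx : R < ‖x‖) : F x = 0 := by
  refine image_eq_zero_of_notMem_tsupport fun hxF => ?_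
  have := h hxF
  rw [mem_closedBall_zero_iff] at this
  linarith

lemma fderiv_eq_zero_of_lt_norm {V : Type} [NormedAddCommGroup V] [NormedSpace ℝ V]
    {F : EuclideanSpace ℝ (Fin d) → V} {R : ℝ} (h : tsupport F ⊆ closedBall 0 R)
    (x : EuclideanSpace ℝ (Fin d)) (hx : R < ‖x‖) : fderiv ℝ F x = 0 := by
  have h' : tsupport (fderiv ℝ F) ⊆ closedBall 0 R := (tsupport_fderiv_subset ℝ).trans h
  exact eq_zero_of_lt_norm h' x hx

lemma opNorm_le_of_single_le {V : Type} [NormedAddCommGroup V] [NormedSpace ℝ V]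
    {A : EuclideanSpace ℝ (Fin d) →L[ℝ] V} {B : ℝ} (hB : 0 ≤ B)
    (h : ∀ i, ‖A (EuclideanSpace.single i 1)‖ ≤ B) : ‖A‖ ≤ d * B := by
  refine A.opNorm_le_bound (by positivity) fun x => ?_
  have hx : x = ∑ i, x i • EuclideanSpace.single i (1 : ℝ) := by
    ext j
    simp [Finset.sum_apply, Pi.single_apply]
  calc ‖A x‖ = ‖∑ i, x i • A (EuclideanSpace.single i 1)‖ := by
        conv_lhs => rw [hx]
        simp
    _ ≤ ∑ _i : Fin d, ‖x‖ * B := by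
        refine norm_sum_le_of_le _ fun i _ => ?_
        rw [norm_smul]
        exact mul_le_mul (PiLp.norm_apply_le x i) (h i) (norm_nonneg _) (norm_nonneg _)
    _ = d * B * ‖x‖ := by simp; ring

/-- A lattice-periodic function whose second derivative is small has a small derivative. -/
lemma norm_latticeSum_fderiv_le {V : Type} [NormedAddCommGroup V] [NormedSpace ℝ V]
    {F : EuclideanSpace ℝ (Fin d) → V} (hF : ContDiff ℝ (⊤ : ℕ∞) F) (hc : HasCompactSupport F)
    {t B : ℝ} (ht : 0 < t)
    (hB : ∀ y, ‖latticeSum (fderiv ℝ (fderiv ℝ F)) t y‖ ≤ B) (y : EuclideanSpace ℝ (Fin d)) :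
    ‖latticeSum (fderiv ℝ F) t y‖ ≤ d * (B * t) := by
  obtain ⟨R, -, hsupp⟩ := exists_tsupport_subset_closedBall hc
  have hB0 : 0 ≤ B := le_trans (norm_nonneg (latticeSum (fderiv ℝ (fderiv ℝ F)) t 0)) (hB 0)
  have hF' : ContDiff ℝ (⊤ : ℕ∞) (fderiv ℝ F) := hF.fderiv_right (by simp)
  have hsupp' : tsupport (fderiv ℝ F) ⊆ closedBall 0 R := (tsupport_fderiv_subset ℝ).trans hsupp
  have h1 : ∀ x, HasFDerivAt (latticeSum F t) (latticeSum (fderiv ℝ F) t x) x := fun x =>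
    hasFDerivAt_latticeSum ht (eq_zero_of_lt_norm hsupp) (hF.differentiable (by simp)) x
      (fderiv_eq_zero_of_lt_norm hsupp)
  have h2 : ∀ x, HasFDerivAt (latticeSum (fderiv ℝ F) t)
      (latticeSum (fderiv ℝ (fderiv ℝ F)) t x) x := fun x =>
    hasFDerivAt_latticeSum ht (fderiv_eq_zero_of_lt_norm hsupp) (hF'.differentiable (by simp)) x
      (fderiv_eq_zero_of_lt_norm hsupp')
  refine opNorm_le_of_single_le (by positivity) fun i => ?_
  set v : EuclideanSpace ℝ (Fin d) := t • EuclideanSpace.single i (1 : ℝ) with hv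
  have hvn : ‖v‖ = t := by simp [hv, norm_smul, abs_of_pos ht]
  have h3 : ∀ x ∈ closedBall y t,
      ‖latticeSum (fderiv ℝ F) t x - latticeSum (fderiv ℝ F) t y‖ ≤ B * t := by
    intro x hx
    refine ((convex_univ (E := EuclideanSpace ℝ (Fin d))).norm_image_sub_le_of_norm_hasFDerivWithin_le
      (fun z _ => (h2 z).hasFDerivWithinAt) (fun z _ => hB z) (Set.mem_univ y)
      (Set.mem_univ x)).trans ?_
    rw [mem_closedBall, dist_eq_norm] at hx
    gcongr
  have h4 := (convex_closedBall y t).norm_image_sub_le_of_norm_hasFDerivWithin_le'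
    (fun z _ => (h1 z).hasFDerivWithinAt) h3 (mem_closedBall_self ht.le)
    (show y + v ∈ closedBall y t by simp [dist_eq_norm, hvn])
  have h5 : latticeSum F t (y + v) = latticeSum F t y := by
    rw [hv, ← intVec_single]
    exact latticeSum_add_smul_intVec F t y _
  rw [h5, sub_self, zero_sub, norm_neg, add_sub_cancel_left, hvn, hv, map_smul, norm_smul,
    Real.norm_eq_abs, abs_of_pos ht, mul_comm] at h4
  exact le_of_mul_le_mul_right h4 ht

lemma exists_norm_latticeSum_fderiv_le (N : ℕ) :
    ∀ {V : Type} [NormedAddCommGroup V] [NormedSpace ℝ V] {F : EuclideanSpace ℝ (Fin d) → V},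
      ContDiff ℝ (⊤ : ℕ∞) F → HasCompactSupport F → ∃ C : ℝ, ∀ t : ℝ, 0 < t → t ≤ 1 →
        ∀ y, ‖latticeSum (fderiv ℝ F) t y‖ ≤ C * t ^ N * (t ^ d)⁻¹ := by
  induction N with
  | zero =>
    intro V _ _ F hF hc
    obtain ⟨R, hR, hsupp⟩ := exists_tsupport_subset_closedBall hc
    obtain ⟨B, hB⟩ := (hc.fderiv (𝕜 := ℝ)).exists_bound_of_continuous
      (hF.continuous_fderiv (by simp))
    refine ⟨(2 * R + 1) ^ d * B, fun t ht ht1 y => ?_⟩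
    refine (norm_latticeSum_le hR ht ht1 (fderiv_eq_zero_of_lt_norm hsupp) hB y).trans_eq ?_
    rw [div_pow]; ring
  | succ N ih =>
    intro V _ _ F hF hc
    obtain ⟨C, hC⟩ := ih (hF.fderiv_right (m := (⊤ : ℕ∞)) (by simp)) (hc.fderiv (𝕜 := ℝ))
    refine ⟨d * C, fun t ht ht1 y => ?_⟩
    refine (norm_latticeSum_fderiv_le hF hc ht (hC t ht ht1) y).trans_eq ?_
    ring

/-- The half-open unit cube. -/
def unitCube (d : ℕ) : Set (EuclideanSpace ℝ (Fin d)) := {x | ∀ i, x i ∈ Set.Ico (0 : ℝ) 1}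

lemma unitCube_eq_preimage : unitCube d =
    (MeasurableEquiv.toLp 2 (Fin d → ℝ)).symm ⁻¹' (Set.univ.pi fun _ => Set.Ico (0 : ℝ) 1) := by
  ext x
  simp [unitCube]

lemma measurableSet_unitCube : MeasurableSet (unitCube d) := by
  rw [unitCube_eq_preimage]
  exact (MeasurableEquiv.measurable _) (MeasurableSet.univ_pi fun _ => measurableSet_Ico)

lemma volume_unitCube : volume (unitCube d) = 1 := by
  rw [unitCube_eq_preimage,
    (EuclideanSpace.volume_preserving_symm_measurableEquiv_toLp (Fin d)).measure_preimage
      (MeasurableSet.univ_pi fun _ => measurableSet_Ico).nullMeasurableSet, volume_pi_pi]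
  simp

lemma norm_le_of_mem_unitCube {x : EuclideanSpace ℝ (Fin d)} (hx : x ∈ unitCube d) :
    ‖x‖ ≤ d := by
  have hx' : x = ∑ i, x i • EuclideanSpace.single i (1 : ℝ) := by
    ext j
    simp [Finset.sum_apply, Pi.single_apply]
  rw [hx']
  refine (norm_sum_le_of_le (n := fun _ => (1 : ℝ)) _ fun i _ => ?_).trans_eq (by simp)
  rw [norm_smul]
  simp [abs_of_nonneg (hx i).1, (hx i).2.le]

lemma intVec_floor_mem_unitCube (x : EuclideanSpace ℝ (Fin d)) :
    x - intVec (fun i => ⌊x i⌋) ∈ unitCube d := fun i => by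
  simp only [PiLp.sub_apply, intVec_apply, Set.mem_Ico]
  exact ⟨by linarith [Int.floor_le (x i)], by linarith [Int.lt_floor_add_one (x i)]⟩

lemma eq_floor_of_sub_intVec_mem_unitCube {x : EuclideanSpace ℝ (Fin d)} {n : Fin d → ℤ}
    (h : x - intVec n ∈ unitCube d) : n = fun i => ⌊x i⌋ := by
  ext i
  have := h i
  simp only [PiLp.sub_apply, intVec_apply, Set.mem_Ico] at this
  exact (Int.floor_eq_iff.2 ⟨by linarith, by linarith⟩).symm

lemma hasSum_setIntegral_unitCube {F : EuclideanSpace ℝ (Fin d) → ℂ} (hF : Integrable F) :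
    HasSum (fun n : Fin d → ℤ => ∫ x in unitCube d, F (x + intVec n)) (∫ x, F x) := by
  let s : (Fin d → ℤ) → Set (EuclideanSpace ℝ (Fin d)) := fun n =>
    (fun x => x - intVec n) ⁻¹' unitCube d
  have hs : ⋃ n, s n = Set.univ :=
    Set.eq_univ_of_forall fun x => Set.mem_iUnion.2 ⟨_, intVec_floor_mem_unitCube x⟩
  have h := hasSum_integral_iUnion (f := F) (μ := volume) (s := s)
    (fun n => measurableSet_unitCube.preimage (measurable_id.sub_const _))
    (fun m n hmn => Set.disjoint_left.2 fun x hm hn => hmn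
      ((eq_floor_of_sub_intVec_mem_unitCube hm).trans
        (eq_floor_of_sub_intVec_mem_unitCube hn).symm)) hF.integrableOn
  rw [hs, setIntegral_univ] at h
  refine h.congr_fun ?_
  intro n
  have := (measurePreserving_sub_right (volume : Measure (EuclideanSpace ℝ (Fin d)))
    (intVec n)).setIntegral_preimage_emb (MeasurableEquiv.subRight (intVec n)).measurableEmbedding
      (fun x => F (x + intVec n)) (unitCube d)
  simpa [s] using this.symm

lemma integral_eq_setIntegral_latticeSum {F : EuclideanSpace ℝ (Fin d) → ℂ} (hF : Continuous F)
    (hc : HasCompactSupport F) {t : ℝ} (ht : 0 < t) :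
    ∫ x in unitCube d, latticeSum F t (t • x) = ((t : ℂ) ^ d)⁻¹ * ∫ x, F x := by
  obtain ⟨R, hR, hsupp⟩ := exists_tsupport_subset_closedBall hc
  have hc' : HasCompactSupport fun x => F (t • x) := hc.comp_smul ht.ne'
  have hF' : Continuous fun x : EuclideanSpace ℝ (Fin d) => F (t • x) := by fun_prop
  let T : Finset (Fin d → ℤ) := latticeBox (R + t * d) t 0
  have hT : ∀ x ∈ unitCube d, ∀ n ∉ T, F (t • x + t • intVec n) = 0 := by
    intro x hx n hn
    refine eq_zero_of_lt_norm hsupp _ (not_le.1 fun h => hn (mem_latticeBox ht ?_))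
    have h1 : 0 + t • intVec n = (t • x + t • intVec n) - t • x := by abel
    rw [h1]
    refine (norm_sub_le _ _).trans (add_le_add h ?_)
    rw [norm_smul, Real.norm_eq_abs, abs_of_pos ht]
    gcongr
    exact norm_le_of_mem_unitCube hx
  have h1 := (hasSum_setIntegral_unitCube (hF'.integrable_of_hasCompactSupport hc')).tsum_eq
  rw [Measure.integral_comp_smul, finrank_euclideanSpace_fin, abs_of_pos (by positivity),
    tsum_eq_sum (s := T)] at h1
  · rw [Complex.real_smul] at h1
    push_cast at h1 ⊢
    rw [← h1, ← integral_finsetSum]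
    · refine setIntegral_congr_fun measurableSet_unitCube fun x hx => ?_
      simp only [smul_add]
      exact tsum_eq_sum fun n hn => hT x hx n hn
    · intro n _
      exact ((hF'.integrable_of_hasCompactSupport hc').comp_add_right (intVec n)).integrableOn
  · intro n hn
    refine setIntegral_eq_zero_of_forall_eq_zero fun x hx => ?_
    rw [smul_add]
    exact hT x hx n hn

/-- Riemann sums of a smooth compactly supported function converge faster than any power of the
mesh size. -/
theorem exists_norm_latticeSum_sub_integral_le {F : EuclideanSpace ℝ (Fin d) → ℂ}
    (hF : ContDiff ℝ (⊤ : ℕ∞) F) (hc : HasCompactSupport F) (N : ℕ) :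
    ∃ C : ℝ, ∀ t : ℝ, 0 < t → t ≤ 1 →
      ‖latticeSum F t 0 - ((t : ℂ) ^ d)⁻¹ * ∫ x, F x‖ ≤ C * t ^ N := by
  obtain ⟨R, hR, hsupp⟩ := exists_tsupport_subset_closedBall hc
  obtain ⟨C, hC⟩ := exists_norm_latticeSum_fderiv_le (N + d) hF hc
  refine ⟨C * d, fun t ht ht1 => ?_⟩
  have h1 : ∀ x, HasFDerivAt (latticeSum F t) (latticeSum (fderiv ℝ F) t x) x := fun x =>
    hasFDerivAt_latticeSum ht (eq_zero_of_lt_norm hsupp) (hF.differentiable (by simp)) x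
      (fderiv_eq_zero_of_lt_norm hsupp)
  have hC' : ∀ y, ‖latticeSum (fderiv ℝ F) t y‖ ≤ C * t ^ N := fun y => by
    refine (hC t ht ht1 y).trans_eq ?_
    rw [pow_add, mul_assoc, mul_assoc, mul_inv_cancel₀ (by positivity), mul_one]
  have hC0 : 0 ≤ C * t ^ N := (norm_nonneg _).trans (hC' 0)
  have hcont : Continuous (latticeSum F t) :=
    continuous_iff_continuousAt.2 fun x => (h1 x).continuousAt
  have hbound : ∀ x ∈ unitCube d, ‖latticeSum F t 0 - latticeSum F t (t • x)‖ ≤ C * d * t ^ N := by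
    intro x hx
    refine ((convex_univ (E := EuclideanSpace ℝ (Fin d))).norm_image_sub_le_of_norm_hasFDerivWithin_le
      (fun z _ => (h1 z).hasFDerivWithinAt) (fun z _ => hC' z) (Set.mem_univ (t • x))
      (Set.mem_univ 0)).trans ?_
    rw [zero_sub, norm_neg, norm_smul, Real.norm_eq_abs, abs_of_pos ht]
    calc C * t ^ N * (t * ‖x‖) ≤ C * t ^ N * (1 * d) := by
          gcongr
          exact norm_le_of_mem_unitCube hx
      _ = _ := by ring
  have hfin : volume (unitCube d) < ⊤ := by rw [volume_unitCube]; simp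
  have h_int : IntegrableOn (fun x => latticeSum F t (t • x)) (unitCube d) := by
    refine Measure.integrableOn_of_bounded hfin.ne
      (M := ‖latticeSum F t 0‖ + C * d * t ^ N) (by fun_prop) ?_
    refine ae_restrict_of_forall_mem measurableSet_unitCube fun x hx => ?_
    have h2 := norm_sub_norm_le (latticeSum F t (t • x)) (latticeSum F t 0)
    rw [norm_sub_rev] at h2
    linarith [hbound x hx]
  have hconst : IntegrableOn (fun _ => latticeSum F t 0) (unitCube d) :=
    integrableOn_const hfin.ne
  have h0 : latticeSum F t 0 = ∫ _x in unitCube d, latticeSum F t 0 := by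
    simp [Measure.real, volume_unitCube]
  rw [← integral_eq_setIntegral_latticeSum hF.continuous hc ht, h0,
    ← integral_sub hconst h_int]
  have := norm_setIntegral_le_of_norm_le_const hfin hbound
  simpa [Measure.real, volume_unitCube] using this

end RiemannSum

section Mellin

lemma mellin_of_rapid_decay {h : ℝ → ℂ} (hloc : LocallyIntegrableOn h (Set.Ioi 0)) {A : ℝ}
    (htop : ∀ t, A < t → h t = 0) (hbot : ∀ N : ℕ, h =O[𝓝[>] 0] fun t : ℝ => t ^ N) (s : ℂ) :
    MellinConvergent h s ∧ DifferentiableAt ℂ (mellin h) s := by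
  obtain ⟨N, hN⟩ := exists_nat_gt (-s.re)
  have h1 : h =O[atTop] fun t : ℝ => t ^ (-(s.re + 1)) := by
    have : h =ᶠ[atTop] fun _ => (0 : ℂ) := by
      filter_upwards [eventually_gt_atTop A] with t ht using htop t ht
    exact this.trans_isBigO (Asymptotics.isBigO_zero _ _)
  have h2 : h =O[𝓝[>] 0] fun t : ℝ => t ^ (-(-(N : ℝ))) := by
    simpa only [neg_neg, Real.rpow_natCast] using hbot N
  exact ⟨mellinConvergent_of_isBigO_rpow hloc h1 (by linarith) h2 (by linarith),
    mellin_differentiableAt_of_isBigO_rpow hloc h1 (by linarith) h2 (by linarith)⟩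

lemma mellin_of_eq_zero_off_Icc {h : ℝ → ℂ} (hc : Continuous h)
    (h0 : ∀ u, u ∉ Set.Icc (1 / 2 : ℝ) 2 → h u = 0) (s : ℂ) :
    MellinConvergent h s ∧ DifferentiableAt ℂ (mellin h) s := by
  refine mellin_of_rapid_decay (hc.continuousOn.locallyIntegrableOn measurableSet_Ioi) (A := 2)
    (fun t ht => h0 t fun h => absurd h.2 (not_le.2 ht)) (fun N => ?_) s
  have : h =ᶠ[𝓝[>] 0] fun _ => (0 : ℂ) := by
    filter_upwards [nhdsWithin_le_nhds (Iio_mem_nhds (by norm_num : (0 : ℝ) < 1 / 2))] with t ht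
    exact h0 t fun h => absurd h.1 (not_le.2 ht)
  exact this.trans_isBigO (Asymptotics.isBigO_zero _ _)

lemma cpow_re_pos_of_log_lt {u : ℝ} (hu : 0 < u) {w : ℂ} (h : |Real.log u * w.im| < 1) :
    0 < ((u : ℂ) ^ w).re := by
  rw [cpow_def_of_ne_zero (by exact_mod_cast hu.ne'), ← ofReal_log hu.le, exp_re, re_ofReal_mul,
    im_ofReal_mul]
  refine mul_pos (Real.exp_pos _) (Real.cos_pos_of_mem_Ioo ?_)
  rw [abs_lt] at h
  have := Real.pi_gt_three
  constructor <;> linarith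

lemma abs_log_le_two_mul {u ε : ℝ} (hε : ε ≤ 1 / 2) (hu : |u - 1| < ε) :
    |Real.log u| ≤ 2 * ε := by
  rw [abs_lt] at hu
  have hu0 : 0 < u := by linarith
  have h1 := Real.log_le_sub_one_of_pos hu0
  have h2 := Real.one_sub_inv_le_log_of_pos hu0
  have h3 : u⁻¹ ≤ 1 + 2 * ε := by
    rw [inv_le_iff_one_le_mul₀ hu0]
    nlinarith
  rw [abs_le]
  constructor <;> linarith

/-- A bump function around `1` whose Mellin transform has no zeros on a given disc. -/
lemma exists_bump_mellin_ne_zero (R : ℝ) (hR : 0 < R) :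
    ∃ η : ℝ → ℝ, ContDiff ℝ (⊤ : ℕ∞) η ∧ (∀ u, 0 ≤ η u) ∧
      (∀ u, u ∉ Set.Icc (1 / 2 : ℝ) 2 → η u = 0) ∧
      ∀ z ∈ ball (0 : ℂ) R, mellin (fun u => (η u : ℂ)) z ≠ 0 := by
  set ε : ℝ := min (1 / 2) (1 / (2 * R)) with hε
  have hε0 : 0 < ε := by positivity
  have hε1 : ε ≤ 1 / 2 := min_le_left _ _
  have hε2 : 2 * ε * R ≤ 1 := by
    have : ε ≤ 1 / (2 * R) := min_le_right _ _
    rw [le_div_iff₀ (by positivity)] at this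
    linarith
  let η : ContDiffBump (1 : ℝ) := ⟨ε / 2, ε, by positivity, by linarith⟩
  have hsupp : Function.support η = ball 1 ε := η.support_eq
  have hmem : ∀ u, η u ≠ 0 → |u - 1| < ε := fun u hu => by
    have : u ∈ ball (1 : ℝ) ε := hsupp ▸ hu
    rwa [mem_ball, Real.dist_eq] at this
  have hoff : ∀ u, u ∉ Set.Icc (1 / 2 : ℝ) 2 → η u = 0 := by
    intro u hu
    by_contra h
    have := abs_lt.1 (hmem u h)
    exact hu ⟨by linarith, by linarith⟩
  refine ⟨η, η.contDiff, fun u => η.nonneg, hoff, fun z hz => ?_⟩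
  have hconv : MellinConvergent (fun u => (η u : ℂ)) z :=
    (mellin_of_eq_zero_off_Icc (continuous_ofReal.comp η.continuous)
      (fun u hu => by simp [hoff u hu]) z).1
  have hpos : ∀ u ∈ ball (1 : ℝ) ε, 0 < ((u : ℂ) ^ (z - 1) • (η u : ℂ)).re := by
    intro u hu
    have hη : 0 < η u := lt_of_le_of_ne η.nonneg (Ne.symm (hsupp.symm ▸ hu : u ∈ Function.support η))
    rw [mem_ball, Real.dist_eq] at hu
    rw [smul_eq_mul, re_mul_ofReal]
    refine mul_pos (cpow_re_pos_of_log_lt (by linarith [(abs_lt.1 hu).1]) ?_) hη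
    rw [mem_ball_zero_iff] at hz
    rw [sub_im, one_im, sub_zero, abs_mul]
    have h1 := abs_log_le_two_mul hε1 hu
    have h2 : |z.im| < R := (abs_im_le_norm z).trans_lt hz
    calc |Real.log u| * |z.im| ≤ 2 * ε * |z.im| := by gcongr
      _ < 2 * ε * R := by gcongr
      _ ≤ 1 := hε2
  have hre : (mellin (fun u => (η u : ℂ)) z).re =
      ∫ u in Set.Ioi (0 : ℝ), ((u : ℂ) ^ (z - 1) • (η u : ℂ)).re :=
    (integral_re hconv).symm
  intro h0
  have : 0 < (mellin (fun u => (η u : ℂ)) z).re := by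
    have h_int : IntegrableOn (fun u : ℝ => ((u : ℂ) ^ (z - 1) • (η u : ℂ)).re) (Set.Ioi 0) :=
      hconv.re
    rw [hre, setIntegral_pos_iff_support_of_nonneg_ae _ h_int]
    · refine (Metric.measure_ball_pos volume (1 : ℝ) hε0).trans_le (measure_mono fun u hu => ?_)
      refine ⟨(hpos u hu).ne', ?_⟩
      rw [mem_ball, Real.dist_eq, abs_lt] at hu
      exact Set.mem_Ioi.2 (by linarith)
    · refine Eventually.of_forall fun u => ?_
      by_cases hu : u ∈ ball (1 : ℝ) ε
      · exact (hpos u hu).le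
      · rw [← hsupp, Function.mem_support, not_not] at hu
        simp [hu]
  rw [h0] at this
  exact lt_irrefl _ this

end Mellin

section Homogeneous

variable {d : ℕ} {f : EuclideanSpace ℝ (Fin d) → ℂ} {b : ℂ}

lemma exists_norm_le_of_homogeneous (hf : ContinuousOn f {x | x ≠ 0})
    (hh : ∀ t : ℝ, 0 < t → ∀ x : EuclideanSpace ℝ (Fin d), x ≠ 0 →
      f (t • x) = (t : ℂ) ^ b * f x) :
    ∃ C, ∀ x : EuclideanSpace ℝ (Fin d), x ≠ 0 → ‖f x‖ ≤ C * ‖x‖ ^ b.re := by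
  have hs : sphere (0 : EuclideanSpace ℝ (Fin d)) 1 ⊆ {x | x ≠ 0} := fun x hx h => by
    simp [h] at hx
  obtain ⟨C, hC⟩ := (isCompact_sphere (0 : EuclideanSpace ℝ (Fin d)) 1).exists_bound_of_continuousOn
    (hf.mono hs)
  refine ⟨C, fun x hx => ?_⟩
  have hx0 : 0 < ‖x‖ := norm_pos_iff.2 hx
  have hu : ‖x‖⁻¹ • x ∈ sphere (0 : EuclideanSpace ℝ (Fin d)) 1 := by
    rw [mem_sphere_zero_iff_norm, norm_smul, norm_inv, norm_norm, inv_mul_cancel₀ hx0.ne']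
  have h1 := hh ‖x‖ hx0 _ (hs hu)
  rw [smul_smul, mul_inv_cancel₀ hx0.ne', one_smul] at h1
  rw [h1, norm_mul, norm_cpow_eq_rpow_re_of_pos hx0, mul_comm]
  gcongr
  exact hC _ hu

/-- A Dirichlet-type series over the nonzero integer vectors converges absolutely in a half-plane
given by the growth of its coefficients. -/
lemma summable_norm_mul_norm_cpow {u : EuclideanSpace ℝ (Fin d) → ℂ} {C r : ℝ}
    (hu : ∀ n : Fin d → ℤ, n ≠ 0 → ‖u (intVec n)‖ ≤ C * ‖intVec n‖ ^ r) {z : ℂ}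
    (hz : r + d < z.re) :
    Summable fun n : {n : Fin d → ℤ // n ≠ 0} =>
      ‖u (intVec n.1) * ((‖intVec n.1‖ : ℝ) : ℂ) ^ (-z)‖ := by
  refine Summable.of_nonneg_of_le (fun _ => norm_nonneg _) (fun n => ?_)
    ((summable_norm_intVec_rpow (d := d) (r := r - z.re) (by linarith)).mul_left C)
  have h0 := norm_intVec_pos n.2
  rw [norm_mul, norm_cpow_eq_rpow_re_of_pos h0, neg_re, sub_eq_add_neg, Real.rpow_add h0,
    ← mul_assoc]
  gcongr
  exact hu n.1 n.2

/-- Integration in polar coordinates of a homogeneous function times a radial one. -/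
lemma integral_homogeneous_mul_radial (hd : 0 < d)
    (hh : ∀ t : ℝ, 0 < t → ∀ x : EuclideanSpace ℝ (Fin d), x ≠ 0 →
      f (t • x) = (t : ℂ) ^ b * f x) (η : ℝ → ℂ) :
    ∫ x, f x * η ‖x‖ = (∫ ω, f ω ∂(sphereMeasure d)) * mellin η (b + d) := by
  have : Nontrivial (EuclideanSpace ℝ (Fin d)) := by
    have : Nonempty (Fin d) := ⟨⟨0, hd⟩⟩
    infer_instance
  let μ : Measure (EuclideanSpace ℝ (Fin d)) := volume
  have hdim : Module.finrank ℝ (EuclideanSpace ℝ (Fin d)) = d := by simp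
  calc
    ∫ x, f x * η ‖x‖
      = ∫ x : ({(0)}ᶜ : Set (EuclideanSpace ℝ (Fin d))), f x * η ‖x.1‖ ∂(μ.comap (↑)) := by
      rw [integral_subtype_comap (measurableSet_singleton _).compl fun x ↦ f x * η ‖x‖,
        restrict_compl_singleton]
    _ = ∫ x, f x.1 * (((x.2 : ℝ) : ℂ) ^ b * η x.2) ∂μ.toSphere.prod
          (.volumeIoiPow (Module.finrank ℝ (EuclideanSpace ℝ (Fin d)) - 1)) := by
      rw [← μ.measurePreserving_homeomorphUnitSphereProd.integral_comp
        (Homeomorph.measurableEmbedding _)]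
      refine integral_congr_ae (Eventually.of_forall fun x => ?_)
      have hx0 : 0 < ‖x.1‖ := norm_pos_iff.2 x.2
      have hx1 : ‖x.1‖⁻¹ • x.1 ≠ 0 := smul_ne_zero (inv_ne_zero hx0.ne') x.2
      have h1 := hh ‖x.1‖ hx0 _ hx1
      rw [smul_smul, mul_inv_cancel₀ hx0.ne', one_smul] at h1
      simp only [homeomorphUnitSphereProd_apply_fst_coe, homeomorphUnitSphereProd_apply_snd_coe]
      rw [h1]
      ring
    _ = (∫ ω, f ω ∂μ.toSphere) * ∫ t : Set.Ioi (0 : ℝ), ((t : ℝ) : ℂ) ^ b * η t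
          ∂.volumeIoiPow (Module.finrank ℝ (EuclideanSpace ℝ (Fin d)) - 1) :=
      integral_prod_mul (fun ω : sphere (0 : EuclideanSpace ℝ (Fin d)) 1 => f ω)
        (fun t : Set.Ioi (0 : ℝ) => ((t : ℝ) : ℂ) ^ b * η t)
    _ = _ := by
      rw [hdim]
      congr 1
      simp only [Measure.volumeIoiPow, ENNReal.ofReal]
      rw [integral_withDensity_eq_integral_smul,
        integral_subtype_comap measurableSet_Ioi
          fun a : ℝ ↦ Real.toNNReal (a ^ (d - 1)) • ((a : ℂ) ^ b * η a), mellin,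
        setIntegral_congr_fun measurableSet_Ioi fun x hx ↦ ?_]
      · have hx0 : (0 : ℝ) < x := hx
        have hx1 : (x : ℂ) ≠ 0 := by exact_mod_cast hx0.ne'
        have h2 : b + d - 1 = b + ((d - 1 : ℕ) : ℂ) := by
          rw [Nat.cast_sub hd]; push_cast; ring
        rw [NNReal.smul_def, Real.coe_toNNReal _ (pow_nonneg hx0.le _), h2, cpow_add _ _ hx1,
          cpow_natCast, real_smul, smul_eq_mul]
        push_cast
        ring
      · exact (measurable_subtype_coe.pow_const _).real_toNNReal

lemma contDiff_homogeneous_mul_radial (hf : ContDiffOn ℝ (⊤ : ℕ∞) f {x | x ≠ 0}) {η : ℝ → ℝ}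
    (hη : ContDiff ℝ (⊤ : ℕ∞) η) (h0 : ∀ u, u ∉ Set.Icc (1 / 2 : ℝ) 2 → η u = 0) :
    ContDiff ℝ (⊤ : ℕ∞) fun x => f x * (η ‖x‖ : ℂ) := by
  rw [contDiff_iff_contDiffAt]
  intro x
  by_cases hx : x = 0
  · subst hx
    have : (fun x => f x * (η ‖x‖ : ℂ)) =ᶠ[𝓝 0] fun _ => 0 := by
      filter_upwards [Metric.ball_mem_nhds (0 : EuclideanSpace ℝ (Fin d))
        (by norm_num : (0 : ℝ) < 1 / 2)] with y hy
      rw [mem_ball_zero_iff] at hy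
      rw [h0 _ fun h => absurd h.1 (not_le.2 hy)]
      simp
    exact contDiffAt_const.congr_of_eventuallyEq this
  · have h1 : ContDiffAt ℝ (⊤ : ℕ∞) f x := hf.contDiffAt (isOpen_ne.mem_nhds hx)
    have h2 : ContDiffAt ℝ (⊤ : ℕ∞) (fun x : EuclideanSpace ℝ (Fin d) => (η ‖x‖ : ℂ)) x :=
      ofRealCLM.contDiff.contDiffAt.comp x (hη.contDiffAt.comp x (contDiffAt_norm ℝ hx))
    exact h1.mul h2

lemma hasCompactSupport_mul_radial {η : ℝ → ℝ}
    (h0 : ∀ u, u ∉ Set.Icc (1 / 2 : ℝ) 2 → η u = 0) :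
    HasCompactSupport fun x => f x * (η ‖x‖ : ℂ) := by
  refine HasCompactSupport.of_support_subset_isCompact
    (isCompact_closedBall (0 : EuclideanSpace ℝ (Fin d)) 2) fun x hx => ?_
  rw [mem_closedBall_zero_iff]
  by_contra h
  exact hx (by simp [h0 _ fun h' => h h'.2])

lemma continuousOn_latticeSum_zero {F : EuclideanSpace ℝ (Fin d) → ℂ} {R : ℝ} (hF : Continuous F)
    (h0 : ∀ x, R < ‖x‖ → F x = 0) : ContinuousOn (fun t => latticeSum F t 0) (Set.Ioi 0) := by
  intro t₀ ht₀
  rw [Set.mem_Ioi] at ht₀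
  refine ContinuousAt.continuousWithinAt ?_
  have : (fun t => latticeSum F t 0) =ᶠ[𝓝 t₀]
      fun t => ∑ n ∈ latticeBox R (t₀ / 2) 0, F (0 + t • intVec n) := by
    filter_upwards [lt_mem_nhds (half_lt_self ht₀)] with t ht
    refine tsum_eq_sum fun n hn => h0 _ (not_le.1 fun h => hn (mem_latticeBox (half_pos ht₀) ?_))
    refine le_trans ?_ h
    rw [zero_add, zero_add, norm_smul, norm_smul, Real.norm_eq_abs, Real.norm_eq_abs,
      abs_of_pos (half_pos ht₀), abs_of_pos ((half_pos ht₀).trans ht)]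
    gcongr
  refine ContinuousAt.congr ?_ this.symm
  fun_prop

/-- The Mellin transform of the theta-like function `t ↦ ∑ F (t n)` of a smooth compactly supported
function vanishing at the origin has a single simple pole, located at `d`. -/
lemma exists_mellin_latticeSum_eq {F : EuclideanSpace ℝ (Fin d) → ℂ}
    (hF : ContDiff ℝ (⊤ : ℕ∞) F) (hc : HasCompactSupport F) (hF0 : F 0 = 0) :
    ∃ H : ℂ → ℂ, Differentiable ℂ H ∧ ∀ s : ℂ, d < s.re →
      mellin (fun t => latticeSum F t 0) s = H s + (∫ x, F x) / (s - d) := by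
  obtain ⟨R, hR, hsupp⟩ := exists_tsupport_subset_closedBall hc
  have hR0 := eq_zero_of_lt_norm hsupp
  let P : ℝ → ℂ := Set.indicator (Set.Ioc 0 1) fun t => (t : ℂ) ^ (-(d : ℂ))
  let I : ℂ := ∫ x, F x
  let G : ℝ → ℂ := fun t => latticeSum F t 0 - I • P t
  have hPloc : LocallyIntegrableOn P (Set.Ioi 0) := by
    have h1 : LocallyIntegrableOn (fun t : ℝ => (t : ℂ) ^ (-(d : ℂ))) (Set.Ioi 0) := by
      refine ContinuousOn.locallyIntegrableOn (fun t ht => ?_) measurableSet_Ioi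
      exact (continuousAt_ofReal_cpow_const t _ (Or.inr (ne_of_gt ht))).continuousWithinAt
    rw [locallyIntegrableOn_iff isOpen_Ioi.isLocallyClosed] at h1 ⊢
    exact fun k hk hk' => (h1 k hk hk').indicator measurableSet_Ioc
  have hG := mellin_of_rapid_decay (h := G) (A := max R 1)
    (((continuousOn_latticeSum_zero hF.continuous hR0).locallyIntegrableOn measurableSet_Ioi).sub
      (hPloc.smul I))
    (fun t ht => ?_) (fun N => ?_)
  · refine ⟨mellin G, fun s => (hG s).2, fun s hs => ?_⟩
    have hP := hasMellin_cpow_Ioc (-(d : ℂ)) (s := s) (by simpa using hs)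
    have h2 := (hasMellin_add (hG s).1 (hP.1.const_smul I)).2
    rw [(hasMellin_const_smul hP.1 I).2, hP.2] at h2
    rw [← sub_eq_add_neg, smul_eq_mul, mul_one_div] at h2
    rw [← h2]
    congr 1
    ext t
    simp [G, P]
  · have hR1 : R < t := (le_max_left _ _).trans_lt ht
    have h1 : 1 < t := (le_max_right _ _).trans_lt ht
    have : latticeSum F t 0 = 0 := by
      refine (tsum_congr fun n => ?_).trans tsum_zero
      by_cases hn : n = 0
      · simp [hn, hF0]
      · refine hR0 _ ?_
        rw [zero_add, norm_smul, Real.norm_eq_abs, abs_of_pos (by linarith)]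
        nlinarith [one_le_norm_intVec hn]
    simp [G, P, this, h1]
  · obtain ⟨C, hC⟩ := exists_norm_latticeSum_sub_integral_le hF hc N
    refine Asymptotics.IsBigO.of_bound C ?_
    filter_upwards [Ioc_mem_nhdsGT one_pos] with t ht
    have h1 := hC t ht.1 ht.2
    have h2 : G t = latticeSum F t 0 - ((t : ℂ) ^ d)⁻¹ * ∫ x, F x := by
      simp only [G, P, Set.indicator_of_mem ht, cpow_neg, cpow_natCast, I, smul_eq_mul]
      ring
    rwa [h2, Real.norm_eq_abs, abs_of_pos (pow_pos ht.1 N)]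

/-- The Mellin transform of the lattice sum of a homogeneous function times a radial bump factors
as a Dirichlet-type series times the Mellin transform of the bump. -/
lemma mellin_latticeSum_homogeneous
    (hh : ∀ t : ℝ, 0 < t → ∀ x : EuclideanSpace ℝ (Fin d), x ≠ 0 →
      f (t • x) = (t : ℂ) ^ b * f x) {η : ℝ → ℝ} (hη : Continuous η) (hpos : ∀ u, 0 ≤ η u)
    (h0 : ∀ u, u ∉ Set.Icc (1 / 2 : ℝ) 2 → η u = 0) {z : ℂ}
    (hs : Summable fun n : {n : Fin d → ℤ // n ≠ 0} =>
      ‖f (intVec n.1) * ((‖intVec n.1‖ : ℝ) : ℂ) ^ (-z)‖) :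
    mellin (fun t => latticeSum (fun x => f x * (η ‖x‖ : ℂ)) t 0) (z - b) =
      mellin (fun u => (η u : ℂ)) z * ∑' n : {n : Fin d → ℤ // n ≠ 0},
        f (intVec n.1) * ((‖intVec n.1‖ : ℝ) : ℂ) ^ (-z) := by
  let M : ℂ → ℂ := mellin fun u => (η u : ℂ)
  have hM : ∀ w, MellinConvergent (fun u => (η u : ℂ)) w := fun w =>
    (mellin_of_eq_zero_off_Icc (continuous_ofReal.comp hη) (fun u hu => by simp [h0 u hu]) w).1
  have hval : ∀ (c : ℂ) (a : ℝ) (w : ℂ), 0 < a →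
      ∫ t in Set.Ioi (0 : ℝ), (t : ℂ) ^ (w - 1) * (c * (η (a * t) : ℂ)) =
        c * (a : ℂ) ^ (-w) * M w := by
    intro c a w ha
    have h1 := mellin_comp_mul_left (fun u => (η u : ℂ)) w ha
    have h2 := mellin_const_smul (fun t => (η (a * t) : ℂ)) w c
    rw [h1] at h2
    simpa only [mellin, smul_eq_mul, mul_assoc] using! h2
  have hconv : ∀ (c : ℂ) (a : ℝ) (w : ℂ), 0 < a →
      IntegrableOn (fun t : ℝ => (t : ℂ) ^ (w - 1) * (c * (η (a * t) : ℂ))) (Set.Ioi 0) := by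
    intro c a w ha
    have h1 := ((MellinConvergent.comp_mul_left ha).2 (hM w)).const_smul c
    simpa only [MellinConvergent, smul_eq_mul] using! h1
  let T : {n : Fin d → ℤ // n ≠ 0} → ℝ → ℂ := fun n t =>
    (t : ℂ) ^ (z - 1) * (f (intVec n.1) * (η (‖intVec n.1‖ * t) : ℂ))
  have hnorm : ∀ n, ∫ t in Set.Ioi (0 : ℝ), ‖T n t‖ =
      ‖f (intVec n.1) * ((‖intVec n.1‖ : ℝ) : ℂ) ^ (-z)‖ * ‖M (z.re : ℂ)‖ := by
    intro n
    have hn := norm_intVec_pos n.2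
    have h1 : ((∫ t in Set.Ioi (0 : ℝ), ‖T n t‖ : ℝ) : ℂ) =
        (‖f (intVec n.1)‖ : ℂ) * ((‖intVec n.1‖ : ℝ) : ℂ) ^ (-(z.re : ℂ)) * M z.re := by
      rw [← hval _ _ _ hn, ← integral_complex_ofReal]
      refine setIntegral_congr_fun measurableSet_Ioi fun t ht => ?_
      have ht0 : (0 : ℝ) < t := ht
      simp only [T, norm_mul, norm_cpow_eq_rpow_re_of_pos ht0, norm_real, Real.norm_eq_abs,
        abs_of_nonneg (hpos _), sub_re, one_re]
      push_cast [ofReal_cpow ht0.le]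
      rfl
    have h2 : 0 ≤ ∫ t in Set.Ioi (0 : ℝ), ‖T n t‖ := integral_nonneg fun _ => norm_nonneg _
    rw [← abs_of_nonneg h2, ← Real.norm_eq_abs, ← norm_real, h1]
    simp only [norm_mul, norm_real, norm_norm, norm_cpow_eq_rpow_re_of_pos hn, neg_re, ofReal_re]
  have hsum := hasSum_integral_of_summable_integral_norm (μ := volume.restrict (Set.Ioi 0))
    (F := T) (fun n => hconv _ _ _ (norm_intVec_pos n.2))
    (by simpa only [hnorm] using! hs.mul_right _)
  have hterm : ∀ n : {n : Fin d → ℤ // n ≠ 0}, ∫ t in Set.Ioi (0 : ℝ), T n t =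
      M z * (f (intVec n.1) * ((‖intVec n.1‖ : ℝ) : ℂ) ^ (-z)) := fun n => by
    rw [hval _ _ _ (norm_intVec_pos n.2), mul_comm]
  simp only [hterm] at hsum
  rw [← tsum_mul_left, hsum.tsum_eq]
  refine setIntegral_congr_fun measurableSet_Ioi fun t ht => ?_
  have ht0 : (0 : ℝ) < t := ht
  have ht1 : (t : ℂ) ≠ 0 := by exact_mod_cast ht0.ne'
  have hη0 : η 0 = 0 := h0 0 (by norm_num)
  simp only [latticeSum, zero_add]
  rw [← tsum_subtype_eq_of_support_subset (s := {n : Fin d → ℤ | n ≠ 0}), smul_eq_mul,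
    ← tsum_mul_left]
  · refine tsum_congr fun n => ?_
    simp only [T]
    rw [hh t ht0 _ (intVec_ne_zero n.2), norm_smul, Real.norm_eq_abs, abs_of_pos ht0, mul_comm t,
      show z - 1 = z - b - 1 + b by ring, cpow_add _ _ ht1]
    ring
  · intro n hn h
    exact hn (by simp [h, hη0])

/-- The Dirichlet-type series of a homogeneous function continues, on any disc, with a single simple
pole. -/
lemma exists_tsum_homogeneous_eq (hd : 0 < d) (hf : ContDiffOn ℝ (⊤ : ℕ∞) f {x | x ≠ 0})
    (hh : ∀ t : ℝ, 0 < t → ∀ x : EuclideanSpace ℝ (Fin d), x ≠ 0 →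
      f (t • x) = (t : ℂ) ^ b * f x) {R : ℝ} (hR : 0 < R) :
    ∃ H : ℂ → ℂ, DifferentiableOn ℂ H (ball 0 R) ∧ ∀ z ∈ ball (0 : ℂ) R, b.re + d < z.re →
      ∑' n : {n : Fin d → ℤ // n ≠ 0}, f (intVec n.1) * ((‖intVec n.1‖ : ℝ) : ℂ) ^ (-z) =
        (∫ ω, f ω ∂(sphereMeasure d)) / (z - (b + d)) + H z := by
  obtain ⟨η, hη, hpos, h0, hM0⟩ := exists_bump_mellin_ne_zero R hR
  obtain ⟨C, hC⟩ := exists_norm_le_of_homogeneous hf.continuousOn hh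
  set M : ℂ → ℂ := mellin fun u => (η u : ℂ) with hMdef
  have hM : Differentiable ℂ M := fun w =>
    (mellin_of_eq_zero_off_Icc (continuous_ofReal.comp hη.continuous)
      (fun u hu => by simp [h0 u hu]) w).2
  obtain ⟨H, hH, hHeq⟩ := exists_mellin_latticeSum_eq (contDiff_homogeneous_mul_radial hf hη h0)
    (hasCompactSupport_mul_radial h0) (by simp [h0 0 (by norm_num)])
  rw [integral_homogeneous_mul_radial hd hh fun u => (η u : ℂ)] at hHeq
  set c := ∫ ω, f ω ∂(sphereMeasure d)
  have hds : Differentiable ℂ (dslope M (b + d)) := by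
    rw [← differentiableOn_univ, differentiableOn_dslope univ_mem]
    exact hM.differentiableOn
  refine ⟨fun z => (H (z - b) - c * dslope M (b + d) z) / M z, ?_, fun z hz hre => ?_⟩
  · refine DifferentiableOn.div ?_ hM.differentiableOn hM0
    fun_prop
  · have hz0 : z - (b + d) ≠ 0 := by
      intro h
      have := congrArg re h
      simp at this
      linarith
    have h1 := mellin_latticeSum_homogeneous hh hη.continuous hpos h0
      (summable_norm_mul_norm_cpow (fun n hn => hC _ (intVec_ne_zero hn)) hre)
    rw [hHeq (z - b) (by simp; linarith), ← hMdef, sub_sub] at h1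
    have h2 := hM0 z hz
    have h3 : dslope M (b + d) z = (M z - M (b + d)) / (z - (b + d)) := by
      rw [dslope_of_ne _ (sub_ne_zero.1 hz0), slope_def_field]
    dsimp only
    rw [h3]
    have h4 := eq_div_of_mul_eq h2 ((mul_comm _ _).trans h1.symm)
    rw [h4]
    field_simp
    ring

end Homogeneous

section Gluing

/-- A function on a half-plane which, on every large disc, is a finite sum of simple fractions plus
a holomorphic function continues meromorphically to the plane. -/
lemma exists_meromorphic_continuation {D : ℂ → ℂ} {p c : ℕ → ℂ} {x₀ : ℝ}
    (hp : Function.Injective p)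
    (h : ∀ R : ℝ, 0 < R → ∃ N : ℕ, (∀ j, N ≤ j → R ≤ ‖p j‖) ∧ ∃ H : ℂ → ℂ,
      DifferentiableOn ℂ H (ball 0 R) ∧ ∀ z ∈ ball (0 : ℂ) R, x₀ < z.re →
        D z = ∑ j ∈ range N, c j / (z - p j) + H z) :
    ∃ F : ℂ → ℂ, AnalyticOnNhd ℂ F {z | ∀ j, z ≠ p j} ∧ (∀ z, x₀ < z.re → F z = D z) ∧
      ∀ j, ∃ g : ℂ → ℂ, AnalyticAt ℂ g (p j) ∧
        ∀ᶠ z in 𝓝[≠] (p j), F z - c j / (z - p j) = g z := by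
  choose! N hN H hH hD using h
  have hfrac : ∀ j z, z ≠ p j → AnalyticAt ℂ (fun w => c j / (w - p j)) z := fun j z hz =>
    analyticAt_const.div (analyticAt_id.sub analyticAt_const) (sub_ne_zero.2 hz)
  have hHan : ∀ R, 0 < R → AnalyticOnNhd ℂ (H R) (ball 0 R) := fun R hR =>
    (hH R hR).analyticOnNhd isOpen_ball
  let ρ : ℝ := |x₀| + 1
  have hρ : 0 < ρ := by positivity
  have hext : ∀ R, 0 < R → ∀ m, ∀ r ≤ R, AnalyticOnNhd ℂ
      (fun z => H R z - ∑ j ∈ Ico (N R) m, c j / (z - p j)) (ball 0 r) := by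
    intro R hR m r hr z hz
    refine (hHan R hR z (ball_subset_ball hr hz)).fun_sub
      (Finset.analyticAt_fun_sum _ fun j hj => hfrac j z fun h => ?_)
    rw [mem_ball_zero_iff, h] at hz
    linarith [hN R hR j (mem_Ico.1 hj).1]
  have hcons : ∀ R R', ρ ≤ R → ρ ≤ R' → ∀ z ∈ ball (0 : ℂ) (min R R'),
      ∑ j ∈ range (N R), c j / (z - p j) + H R z =
        ∑ j ∈ range (N R'), c j / (z - p j) + H R' z := by
    intro R R' hR hR' z hz
    have hR0 := hρ.trans_le hR
    have hR0' := hρ.trans_le hR'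
    let m := max (N R) (N R')
    have hsplit : ∀ k ≤ m, ∀ w, ∑ j ∈ range m, c j / (w - p j) =
        ∑ j ∈ range k, c j / (w - p j) + ∑ j ∈ Ico k m, c j / (w - p j) := fun k hk w =>
      (sum_range_add_sum_Ico _ hk).symm
    have hz₁ : ((x₀ + 1 / 2 : ℝ) : ℂ) ∈ ball (0 : ℂ) (min R R') ∩ {w | x₀ < w.re} := by
      refine ⟨?_, by simp⟩
      rw [mem_ball_zero_iff, norm_real, Real.norm_eq_abs]
      refine lt_of_lt_of_le ?_ (le_min hR hR')
      refine (abs_add_le _ _).trans_lt ?_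
      simp only [ρ]
      norm_num
    have hopen : IsOpen (ball (0 : ℂ) (min R R') ∩ {w | x₀ < w.re}) :=
      isOpen_ball.inter (isOpen_lt continuous_const continuous_re)
    have heq := (hext R hR0 m _ (min_le_left R R')).eqOn_of_preconnected_of_eventuallyEq
      (hext R' hR0' m _ (min_le_right R R')) (convex_ball _ _).isPreconnected hz₁.1
      (by
        filter_upwards [hopen.mem_nhds hz₁] with w hw
        have h1 := hD R hR0 w (ball_subset_ball (min_le_left _ _) hw.1) hw.2
        have h2 := hD R' hR0' w (ball_subset_ball (min_le_right _ _) hw.1) hw.2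
        have h3 := hsplit (N R) (le_max_left _ _) w
        have h4 := hsplit (N R') (le_max_right _ _) w
        linear_combination h2 - h1 + h3 - h4) hz
    have h3 := hsplit (N R) (le_max_left _ _) z
    have h4 := hsplit (N R') (le_max_right _ _) z
    simp only at heq
    linear_combination heq + h4 - h3
  let F : ℂ → ℂ := fun z =>
    ∑ j ∈ range (N (ρ + ‖z‖)), c j / (z - p j) + H (ρ + ‖z‖) z
  have hF : ∀ R, ρ ≤ R → ∀ z ∈ ball (0 : ℂ) R,
      F z = ∑ j ∈ range (N R), c j / (z - p j) + H R z := by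
    intro R hR z hz
    refine hcons _ _ (by simp) hR z ?_
    rw [mem_ball_zero_iff] at hz ⊢
    exact lt_min (by linarith) hz
  have hmem : ∀ z : ℂ, z ∈ ball (0 : ℂ) (ρ + ‖z‖) := fun z => by
    rw [mem_ball_zero_iff]; linarith
  have hρz : ∀ z : ℂ, ρ ≤ ρ + ‖z‖ := fun z => by simp
  refine ⟨F, fun z hz => ?_, fun z hz => ?_, fun j => ?_⟩
  · have h1 : AnalyticAt ℂ (fun w => ∑ j ∈ range (N (ρ + ‖z‖)), c j / (w - p j) +
        H (ρ + ‖z‖) w) z :=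
      (Finset.analyticAt_fun_sum _ fun j _ => hfrac j z (hz j)).fun_add
        (hHan _ (hρ.trans_le (hρz z)) z (hmem z))
    refine h1.congr ?_
    filter_upwards [isOpen_ball.mem_nhds (hmem z)] with w hw
    exact (hF _ (hρz z) w hw).symm
  · exact (hD _ (hρ.trans_le (hρz z)) z (hmem z) hz).symm
  · let R := ρ + ‖p j‖
    have hR0 : 0 < R := hρ.trans_le (hρz _)
    have hj : j ∈ range (N R) := by
      rw [Finset.mem_range]
      by_contra hj
      have := hN R hR0 j (not_lt.1 hj)
      simp only [R] at this
      linarith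
    refine ⟨fun z => ∑ i ∈ (range (N R)).erase j, c i / (z - p i) + H R z, ?_, ?_⟩
    · exact (Finset.analyticAt_fun_sum _ fun i hi => hfrac i _ fun h =>
        (ne_of_mem_erase hi) (hp h).symm).fun_add (hHan R hR0 _ (hmem _))
    · refine nhdsWithin_le_nhds ?_
      filter_upwards [isOpen_ball.mem_nhds (hmem (p j))] with w hw
      rw [hF _ (hρz _) w hw, ← add_sum_erase _ _ hj]
      ring

end Gluing

section Symbol

variable {d : ℕ}

lemma one_add_rpow_le {x : ℝ} (hx : 1 ≤ x) (e : ℝ) : (1 + x) ^ e ≤ 2 ^ |e| * x ^ e := by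
  have hx0 : 0 < x := by linarith
  rcases le_total 0 e with he | he
  · rw [abs_of_nonneg he, ← Real.mul_rpow (by norm_num) hx0.le]
    exact Real.rpow_le_rpow (by linarith) (by linarith) he
  · calc (1 + x) ^ e ≤ 1 * x ^ e := by
          rw [one_mul]
          exact Real.rpow_le_rpow_of_nonpos hx0 (by linarith) he
      _ ≤ 2 ^ |e| * x ^ e := by
          gcongr
          exact Real.one_le_rpow (by norm_num) (abs_nonneg e)

lemma IsClassicalSymbol.exists_norm_sub_sum_le {χ : EuclideanSpace ℝ (Fin d) → ℝ} {a : ℂ}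
    {σ : EuclideanSpace ℝ (Fin d) → ℂ} {σh : ℕ → EuclideanSpace ℝ (Fin d) → ℂ}
    (hσ : IsClassicalSymbol χ a σ σh) (hχ : IsCutoff χ) (N : ℕ) :
    ∃ C, ∀ n : Fin d → ℤ, n ≠ 0 →
      ‖σ (intVec n) - ∑ j ∈ range N, σh j (intVec n)‖ ≤ C * ‖intVec n‖ ^ (a.re - N) := by
  obtain ⟨C, hC⟩ := hσ.estimate N 0
  refine ⟨C * 2 ^ |a.re - N|, fun n hn => ?_⟩
  have h1 := hC (intVec n)
  have hn1 := one_le_norm_intVec hn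
  simp only [norm_iteratedFDeriv_zero, hχ.eq_one_far _ hn1, ofReal_one, one_mul, Nat.cast_zero,
    sub_zero] at h1
  have hC0 : 0 ≤ C := by
    have h2 := (norm_nonneg _).trans h1
    exact nonneg_of_mul_nonneg_left h2 (by positivity)
  calc _ ≤ _ := h1
    _ ≤ C * (2 ^ |a.re - N| * ‖intVec n‖ ^ (a.re - N)) := by
      gcongr
      exact one_add_rpow_le hn1 _
    _ = _ := by ring

lemma differentiableOn_tsum_norm_cpow {u : EuclideanSpace ℝ (Fin d) → ℂ} {C r R : ℝ}
    (hu : ∀ n : Fin d → ℤ, n ≠ 0 → ‖u (intVec n)‖ ≤ C * ‖intVec n‖ ^ r) (hR : r + d < -R) :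
    DifferentiableOn ℂ (fun z : ℂ => ∑' n : {n : Fin d → ℤ // n ≠ 0},
      u (intVec n.1) * ((‖intVec n.1‖ : ℝ) : ℂ) ^ (-z)) (ball 0 R) := by
  refine differentiableOn_tsum_of_summable_norm
    ((summable_norm_intVec_rpow (d := d) (r := r + R) (by linarith)).mul_left C)
    (fun n => ?_) isOpen_ball (fun n z hz => ?_)
  · have hn : ((‖intVec n.1‖ : ℝ) : ℂ) ≠ 0 := by exact_mod_cast (norm_intVec_pos n.2).ne'
    intro z _
    exact ((differentiableAt_id.fun_neg.const_cpow (Or.inl hn)).const_mul _).differentiableWithinAt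
  · have h0 := norm_intVec_pos n.2
    rw [mem_ball_zero_iff] at hz
    have h1 : -z.re ≤ R := (neg_le_abs _).trans ((abs_re_le_norm z).trans hz.le)
    rw [norm_mul, norm_cpow_eq_rpow_re_of_pos h0, neg_re, Real.rpow_add h0, ← mul_assoc]
    refine mul_le_mul (hu n.1 n.2) (Real.rpow_le_rpow_of_exponent_le (one_le_norm_intVec n.2) h1)
      (by positivity) ((norm_nonneg _).trans (hu n.1 n.2))

/-- On any disc, the Dirichlet-type series of a classical symbol is a finite sum of simple
fractions plus a holomorphic function. -/
lemma IsClassicalSymbol.exists_tsum_eq_on_ball (hd : 0 < d) {χ : EuclideanSpace ℝ (Fin d) → ℝ}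
    {a : ℂ} {σ : EuclideanSpace ℝ (Fin d) → ℂ} {σh : ℕ → EuclideanSpace ℝ (Fin d) → ℂ}
    (hσ : IsClassicalSymbol χ a σ σh) (hχ : IsCutoff χ) (R : ℝ) (hR : 0 < R) :
    ∃ N : ℕ, (∀ j : ℕ, N ≤ j → R ≤ ‖a + d - j‖) ∧ ∃ H : ℂ → ℂ,
      DifferentiableOn ℂ H (ball 0 R) ∧ ∀ z ∈ ball (0 : ℂ) R, a.re + d < z.re →
        ∑' n : {n : Fin d → ℤ // n ≠ 0}, σ (intVec n.1) * ((‖intVec n.1‖ : ℝ) : ℂ) ^ (-z) =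
          ∑ j ∈ range N, (∫ ω, σh j ω ∂(sphereMeasure d)) / (z - (a + d - j)) + H z := by
  obtain ⟨N, hN⟩ := exists_nat_gt (a.re + d + R)
  obtain ⟨C, hC⟩ := hσ.exists_norm_sub_sum_le hχ N
  choose E hE hEeq using fun j =>
    exists_tsum_homogeneous_eq hd (hσ.smooth_homog j) (hσ.homog j) hR
  let u : EuclideanSpace ℝ (Fin d) → ℂ := fun x => σ x - ∑ j ∈ range N, σh j x
  refine ⟨N, fun j hj => ?_, fun z : ℂ => ∑' n : {n : Fin d → ℤ // n ≠ 0},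
      u (intVec n.1) * ((‖intVec n.1‖ : ℝ) : ℂ) ^ (-z) + ∑ j ∈ range N, E j z, ?_, ?_⟩
  · have h1 : (N : ℝ) ≤ j := by exact_mod_cast hj
    refine le_trans ?_ (abs_re_le_norm _)
    refine le_trans ?_ (neg_le_abs _)
    simp only [sub_re, add_re, natCast_re]
    linarith
  · exact (differentiableOn_tsum_norm_cpow (u := u) hC (by linarith)).fun_add
      (DifferentiableOn.fun_sum fun j _ => hE j)
  · intro z hz hre
    have hj : ∀ j : ℕ, (a - j).re + d < z.re := fun j => by
      have : (0 : ℝ) ≤ j := Nat.cast_nonneg j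
      simp only [sub_re, natCast_re]
      linarith
    have hs : ∀ j, Summable fun n : {n : Fin d → ℤ // n ≠ 0} =>
        σh j (intVec n.1) * ((‖intVec n.1‖ : ℝ) : ℂ) ^ (-z) := fun j => by
      obtain ⟨C', hC'⟩ := exists_norm_le_of_homogeneous (hσ.smooth_homog j).continuousOn
        (hσ.homog j)
      exact (summable_norm_mul_norm_cpow (fun n hn => hC' _ (intVec_ne_zero hn)) (hj j)).of_norm
    have hsu : Summable fun n : {n : Fin d → ℤ // n ≠ 0} =>
        u (intVec n.1) * ((‖intVec n.1‖ : ℝ) : ℂ) ^ (-z) :=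
      (summable_norm_mul_norm_cpow (u := u) hC
        (by linarith [(Nat.cast_nonneg N : (0 : ℝ) ≤ N)])).of_norm
    have hsplit : ∀ n : {n : Fin d → ℤ // n ≠ 0},
        σ (intVec n.1) * ((‖intVec n.1‖ : ℝ) : ℂ) ^ (-z) =
          u (intVec n.1) * ((‖intVec n.1‖ : ℝ) : ℂ) ^ (-z) +
            ∑ j ∈ range N, σh j (intVec n.1) * ((‖intVec n.1‖ : ℝ) : ℂ) ^ (-z) := fun n => by
      simp only [u, ← Finset.sum_mul]
      ring
    rw [tsum_congr hsplit, hsu.tsum_add (summable_sum fun j _ => hs j),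
      Summable.tsum_finsetSum fun j _ => hs j, add_left_comm, ← Finset.sum_add_distrib]
    congr 1
    refine Finset.sum_congr rfl fun j _ => ?_
    rw [hEeq j z hz (hj j), show a - j + d = a + d - (j : ℂ) by ring]

end Symbol

/-- **Meromorphic continuation of the Dirichlet-type series `Σ_{n∈ℤ^d∖{0}} σ(n)|n|^{−z}` of a
classical symbol `σ` of order `a` on `ℝ^d`:** the series converges absolutely for
`Re(z) > Re(a)+d`, and it extends to a function analytic off `{a+d−j : j ∈ ℕ}` with at most
simple poles at the points `a+d−j` of residue `∫_{S^{d−1}} σ_{a−j} dμ_S`. -/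
theorem dirichlet_series_meromorphic_continuation {d : ℕ} (hd : 0 < d)
    (χ : EuclideanSpace ℝ (Fin d) → ℝ) (hχ : IsCutoff χ) (a : ℂ)
    (σ : EuclideanSpace ℝ (Fin d) → ℂ) (σh : ℕ → EuclideanSpace ℝ (Fin d) → ℂ)
    (hσ : IsClassicalSymbol χ a σ σh) :
    (∀ z : ℂ, a.re + d < z.re →
      Summable (fun n : {n : Fin d → ℤ // n ≠ 0} =>
        ‖σ (intVec n.1) * ((‖intVec n.1‖ : ℝ) : ℂ) ^ (-z)‖)) ∧
    ∃ F : ℂ → ℂ,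
      AnalyticOnNhd ℂ F {z : ℂ | ∀ j : ℕ, z ≠ a + (d : ℂ) - (j : ℂ)} ∧
      (∀ z : ℂ, a.re + d < z.re →
        F z = ∑' n : {n : Fin d → ℤ // n ≠ 0},
          σ (intVec n.1) * ((‖intVec n.1‖ : ℝ) : ℂ) ^ (-z)) ∧
      ∀ j : ℕ, ∃ g : ℂ → ℂ, AnalyticAt ℂ g (a + (d : ℂ) - (j : ℂ)) ∧
        ∀ᶠ z in 𝓝[≠] (a + (d : ℂ) - (j : ℂ)),
          F z - (∫ ω : sphere (0 : EuclideanSpace ℝ (Fin d)) 1, σh j ω ∂(sphereMeasure d))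
              / (z - (a + (d : ℂ) - (j : ℂ))) = g z := by
  obtain ⟨C, hC⟩ := hσ.exists_norm_sub_sum_le hχ 0
  simp only [range_zero, sum_empty, sub_zero, Nat.cast_zero] at hC
  have hinj : Function.Injective fun j : ℕ => a + (d : ℂ) - (j : ℂ) := fun i j hij =>
    Nat.cast_injective (sub_right_injective hij)
  obtain ⟨F, hF, hF', hpole⟩ :=
    exists_meromorphic_continuation hinj (hσ.exists_tsum_eq_on_ball hd hχ)
  exact ⟨fun z hz => summable_norm_mul_norm_cpow hC hz, F, hF, hF', hpole⟩
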